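/- arXiv:1412.3483 — 3 statements merged into one kernel-verified Lean document; each statement's English description precedes it below -/
import Mathlib

section
/- Let Γ be a group with a finite generating set, equipped with the associated word metric, and let Γ act on a metric space X by isometries. Equip X × Γ with the sum product metric d((x,g),(x',g')) = d_X(x,x') + d_Γ(g,g') and the diagonal left Γ-action γ·(x,g) = (γx, γg). Then: (1) for all (x,g), (x',g') the infimum over γ ∈ Γ of d((x,g), γ·(x',g')) is attained, so the orbit metric d_{X^{bdd}}([(x,g)],[(x',g')]) = inf_{γ} d((x,g), γ·(x',g')) makes the orbit set X^{bdd} = (X × Γ)/Γ a metric space; (2) the natural map b : X → X^{bdd} given by b(x) = [(x,e)] is a bijection; and (3) b is a coarse map: it is eventually continuous with l(r) = r and proper. -/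
/-- The word length of `g` with respect to a generating set `Sgen`: the least `n` such that
`g` is a product of `n` generators or inverses of generators. -/
noncomputable def wordLength {Γ : Type*} [Group Γ] (Sgen : Set Γ) (g : Γ) : ℕ :=
  sInf {n : ℕ | ∃ w : Fin n → Γ, (∀ i, w i ∈ Sgen ∨ (w i)⁻¹ ∈ Sgen) ∧ (List.ofFn w).prod = g}

/-- The sum product metric on `X × Γ`: the metric on `X` plus the word metric on `Γ`. -/
noncomputable def prodDist {X : Type*} [MetricSpace X] {Γ : Type*} [Group Γ]
    (Sgen : Set Γ) (p q : X × Γ) : ℝ :=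
  dist p.1 q.1 + (wordLength Sgen (p.2⁻¹ * q.2) : ℝ)

/-- The orbit distance on `X^{bdd} = (X × Γ)/Γ`, computed on representatives: the infimum
over `γ ∈ Γ` of the product distance from `p` to `γ • q`, where the action on `X × Γ`
is diagonal (`γ • (x, g) = (γ • x, γ * g)`). -/
noncomputable def bddDist {X : Type*} [MetricSpace X] {Γ : Type*} [Group Γ] [MulAction Γ X]
    (Sgen : Set Γ) (p q : X × Γ) : ℝ :=
  ⨅ γ : Γ, prodDist Sgen p (γ • q)

section WordLength

variable {Γ : Type*} [Group Γ] {S : Set Γ}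

theorem wordLength_le_length {l : List Γ} (hl : ∀ x ∈ l, x ∈ S ∨ x⁻¹ ∈ S) :
    wordLength S l.prod ≤ l.length :=
  Nat.sInf_le ⟨l.get, fun i => hl _ (l.get_mem i), by rw [List.ofFn_get]⟩

theorem exists_word_length_eq_wordLength (hS : Subgroup.closure S = ⊤) (g : Γ) :
    ∃ w : Fin (wordLength S g) → Γ,
      (∀ i, w i ∈ S ∨ (w i)⁻¹ ∈ S) ∧ (List.ofFn w).prod = g := by
  obtain ⟨l, hl, rfl⟩ := Submonoid.exists_list_of_mem_closure (s := S ∪ S⁻¹) (x := g)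
    (by rw [← Subgroup.closure_toSubmonoid, hS]; exact Subgroup.mem_top g)
  exact Nat.sInf_mem (s := {n : ℕ | ∃ w : Fin n → Γ,
    (∀ i, w i ∈ S ∨ (w i)⁻¹ ∈ S) ∧ (List.ofFn w).prod = l.prod})
    ⟨l.length, l.get, fun i => hl _ (l.get_mem i), by rw [List.ofFn_get]⟩

theorem exists_list_length_eq_wordLength (hS : Subgroup.closure S = ⊤) (g : Γ) :
    ∃ l : List Γ, (∀ x ∈ l, x ∈ S ∨ x⁻¹ ∈ S) ∧ l.length = wordLength S g ∧ l.prod = g := by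
  obtain ⟨w, hw, hg⟩ := exists_word_length_eq_wordLength hS g
  exact ⟨List.ofFn w, by simpa [List.mem_ofFn] using hw, List.length_ofFn, hg⟩

@[simp]
theorem wordLength_one : wordLength S 1 = 0 := by
  simpa using wordLength_le_length (S := S) (l := []) (by simp)

theorem eq_one_of_wordLength_eq_zero (hS : Subgroup.closure S = ⊤) {g : Γ}
    (hg : wordLength S g = 0) : g = 1 := by
  obtain ⟨l, -, hlen, rfl⟩ := exists_list_length_eq_wordLength hS g
  rw [hg, List.length_eq_zero_iff] at hlen
  simp [hlen]

theorem wordLength_mul_le (hS : Subgroup.closure S = ⊤) (g h : Γ) :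
    wordLength S (g * h) ≤ wordLength S g + wordLength S h := by
  obtain ⟨l, hl, hlen, hg⟩ := exists_list_length_eq_wordLength hS g
  obtain ⟨m, hm, hmlen, hh⟩ := exists_list_length_eq_wordLength hS h
  have := wordLength_le_length (S := S) (l := l ++ m) (by
    intro x hx
    rcases List.mem_append.1 hx with hx | hx
    exacts [hl x hx, hm x hx])
  rwa [List.prod_append, List.length_append, hlen, hmlen, hg, hh] at this

theorem wordLength_inv_le (hS : Subgroup.closure S = ⊤) (g : Γ) :
    wordLength S g⁻¹ ≤ wordLength S g := by
  obtain ⟨l, hl, hlen, hg⟩ := exists_list_length_eq_wordLength hS g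
  have := wordLength_le_length (S := S) (l := (l.map (·⁻¹)).reverse) (by
    intro x hx
    obtain ⟨y, hy, rfl⟩ := List.mem_map.1 (List.mem_reverse.1 hx)
    simpa using (hl y hy).symm)
  rwa [← List.prod_inv_reverse, List.length_reverse, List.length_map, hlen, hg] at this

theorem wordLength_inv (hS : Subgroup.closure S = ⊤) (g : Γ) :
    wordLength S g⁻¹ = wordLength S g :=
  (wordLength_inv_le hS g).antisymm (by simpa using wordLength_inv_le hS g⁻¹)

theorem finite_setOf_wordLength_le (hfin : S.Finite) (hS : Subgroup.closure S = ⊤) (N : ℕ) :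
    {g : Γ | wordLength S g ≤ N}.Finite := by
  have hT : {x : Γ | x ∈ S ∨ x⁻¹ ∈ S}.Finite := hfin.union hfin.inv
  refine ((Set.finite_Iic N).biUnion fun n _ =>
    (Set.Finite.pi' fun _ : Fin n => hT).image fun w => (List.ofFn w).prod).subset ?_
  intro g hg
  obtain ⟨w, hw, hwg⟩ := exists_word_length_eq_wordLength hS g
  exact Set.mem_biUnion (x := wordLength S g) hg ⟨w, hw, hwg⟩

end WordLength

theorem bijective_mk_prod_one {X Γ : Type*} [Group Γ] [MulAction Γ X] :
    Function.Bijective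
      (fun x : X => Quotient.mk (MulAction.orbitRel Γ (X × Γ)) (x, (1 : Γ))) := by
  constructor
  · intro x y hxy
    obtain ⟨γ, hγ⟩ := MulAction.orbitRel_apply.1 (Quotient.exact hxy)
    obtain ⟨h₁, h₂⟩ := Prod.ext_iff.1 hγ
    have : γ = 1 := by simpa using h₂
    simpa [this] using h₁.symm
  · intro z
    induction z using Quotient.inductionOn with
    | h p =>
      exact ⟨p.2⁻¹ • p.1, Quotient.sound
        (MulAction.orbitRel_apply.2 ⟨p.2⁻¹, Prod.ext rfl (inv_mul_cancel p.2)⟩)⟩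

section OrbitDistance

variable {X : Type*} [MetricSpace X] {Γ : Type*} [Group Γ] {S : Set Γ}

theorem prodDist_nonneg (p q : X × Γ) : 0 ≤ prodDist S p q := by
  unfold prodDist
  positivity

theorem prodDist_self (p : X × Γ) : prodDist S p p = 0 := by
  simp [prodDist]

theorem prodDist_comm (hS : Subgroup.closure S = ⊤) (p q : X × Γ) :
    prodDist S p q = prodDist S q p := by
  rw [prodDist, prodDist, dist_comm, ← wordLength_inv hS (p.2⁻¹ * q.2), mul_inv_rev, inv_inv]

theorem prodDist_triangle (hS : Subgroup.closure S = ⊤) (p q r : X × Γ) :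
    prodDist S p r ≤ prodDist S p q + prodDist S q r := by
  have h : (wordLength S (p.2⁻¹ * r.2) : ℝ) ≤
      wordLength S (p.2⁻¹ * q.2) + wordLength S (q.2⁻¹ * r.2) := by
    have := wordLength_mul_le hS (p.2⁻¹ * q.2) (q.2⁻¹ * r.2)
    rw [mul_assoc, mul_inv_cancel_left] at this
    exact_mod_cast this
  have := dist_triangle p.1 q.1 r.1
  unfold prodDist
  linarith

theorem eq_of_prodDist_eq_zero (hS : Subgroup.closure S = ⊤) {p q : X × Γ}
    (h : prodDist S p q = 0) : p = q := by
  obtain ⟨h₁, h₂⟩ := (add_eq_zero_iff_of_nonneg dist_nonneg (Nat.cast_nonneg _)).1 h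
  exact Prod.ext (dist_eq_zero.1 h₁)
    (inv_mul_eq_one.1 (eq_one_of_wordLength_eq_zero hS (Nat.cast_eq_zero.1 h₂)))

variable [MulAction Γ X]

theorem prodDist_smul_smul (hiso : ∀ γ : Γ, Isometry (fun x : X => γ • x)) (γ : Γ)
    (p q : X × Γ) : prodDist S (γ • p) (γ • q) = prodDist S p q := by
  simp only [prodDist, Prod.smul_fst, Prod.smul_snd, smul_eq_mul, (hiso γ).dist_eq]
  congr 3
  group

theorem finite_setOf_prodDist_smul_le (hfin : S.Finite) (hS : Subgroup.closure S = ⊤)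
    (p q : X × Γ) (C : ℝ) : {γ : Γ | prodDist S p (γ • q) ≤ C}.Finite := by
  refine ((finite_setOf_wordLength_le hfin hS ⌊C⌋₊).preimage
    (f := fun γ : Γ => p.2⁻¹ * (γ * q.2)) ?_).subset fun γ hγ => ?_
  · intro a _ b _ hab
    simpa using hab
  · refine Nat.le_floor (le_trans ?_ hγ)
    simp [prodDist]

theorem exists_forall_prodDist_smul_le (hfin : S.Finite) (hS : Subgroup.closure S = ⊤)
    (p q : X × Γ) : ∃ γ₀ : Γ, ∀ γ : Γ, prodDist S p (γ₀ • q) ≤ prodDist S p (γ • q) := by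
  obtain ⟨γ₀, h₀, hmin⟩ := Set.exists_min_image _ (fun γ : Γ => prodDist S p (γ • q))
    (finite_setOf_prodDist_smul_le hfin hS p q (prodDist S p ((1 : Γ) • q))) ⟨1, Set.mem_ofPred.2 le_rfl⟩
  refine ⟨γ₀, fun γ => ?_⟩
  rcases le_total (prodDist S p (γ • q)) (prodDist S p ((1 : Γ) • q)) with h | h
  exacts [hmin γ h, le_trans h₀ h]

theorem bddDist_le_prodDist_smul (p q : X × Γ) (γ : Γ) :
    bddDist S p q ≤ prodDist S p (γ • q) :=
  ciInf_le ⟨0, by rintro _ ⟨γ, rfl⟩; exact prodDist_nonneg _ _⟩ γ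

theorem bddDist_le_prodDist (p q : X × Γ) : bddDist S p q ≤ prodDist S p q := by
  simpa using bddDist_le_prodDist_smul (S := S) p q 1

theorem exists_bddDist_eq_prodDist_smul (hfin : S.Finite) (hS : Subgroup.closure S = ⊤)
    (p q : X × Γ) : ∃ γ : Γ, bddDist S p q = prodDist S p (γ • q) := by
  obtain ⟨γ₀, h₀⟩ := exists_forall_prodDist_smul_le hfin hS p q
  exact ⟨γ₀, (bddDist_le_prodDist_smul p q γ₀).antisymm (le_ciInf h₀)⟩

theorem bddDist_nonneg (p q : X × Γ) : 0 ≤ bddDist S p q :=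
  Real.iInf_nonneg fun _ => prodDist_nonneg _ _

theorem bddDist_smul_right (γ : Γ) (p q : X × Γ) :
    bddDist S p (γ • q) = bddDist S p q := by
  refine (Equiv.mulRight γ).iInf_congr fun γ' => ?_
  rw [Equiv.coe_mulRight, mul_smul]

theorem bddDist_comm (hiso : ∀ γ : Γ, Isometry (fun x : X => γ • x))
    (hS : Subgroup.closure S = ⊤) (p q : X × Γ) : bddDist S p q = bddDist S q p := by
  refine (Equiv.inv Γ).iInf_congr fun γ => ?_
  rw [Equiv.inv_apply, ← prodDist_smul_smul hiso γ, smul_inv_smul, prodDist_comm hS]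

theorem bddDist_triangle (hiso : ∀ γ : Γ, Isometry (fun x : X => γ • x)) (hfin : S.Finite)
    (hS : Subgroup.closure S = ⊤) (p q r : X × Γ) :
    bddDist S p r ≤ bddDist S p q + bddDist S q r := by
  obtain ⟨α, hα⟩ := exists_bddDist_eq_prodDist_smul hfin hS p q
  obtain ⟨β, hβ⟩ := exists_bddDist_eq_prodDist_smul hfin hS q r
  calc bddDist S p r ≤ prodDist S p ((α * β) • r) := bddDist_le_prodDist_smul _ _ _
    _ ≤ prodDist S p (α • q) + prodDist S (α • q) ((α * β) • r) := prodDist_triangle hS _ _ _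
    _ = bddDist S p q + bddDist S q r := by
      rw [mul_smul, prodDist_smul_smul hiso, hα, hβ]

theorem mem_orbit_of_bddDist_eq_zero (hfin : S.Finite) (hS : Subgroup.closure S = ⊤)
    {p q : X × Γ} (h : bddDist S p q = 0) : q ∈ MulAction.orbit Γ p := by
  obtain ⟨γ, hγ⟩ := exists_bddDist_eq_prodDist_smul hfin hS p q
  exact ⟨γ⁻¹, inv_smul_eq_iff.2 (eq_of_prodDist_eq_zero hS (hγ.symm.trans h))⟩

theorem isBounded_of_bddDist_le (hfin : S.Finite) (hS : Subgroup.closure S = ⊤)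
    {B : Set X} {p : X × Γ} {C : ℝ} (h : ∀ x ∈ B, bddDist S (x, (1 : Γ)) p ≤ C) :
    Bornology.IsBounded B := by
  have hF : {γ : Γ | wordLength S (γ * p.2) ≤ ⌊C⌋₊}.Finite :=
    (finite_setOf_wordLength_le hfin hS ⌊C⌋₊).preimage (mul_left_injective p.2).injOn
  refine ((Bornology.isBounded_biUnion hF).2 fun γ _ =>
    Metric.isBounded_closedBall (x := γ • p.1) (r := C)).subset fun x hx => ?_
  obtain ⟨γ, hγ⟩ := exists_bddDist_eq_prodDist_smul hfin hS (x, (1 : Γ)) p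
  have hC : dist x (γ • p.1) + (wordLength S (γ * p.2) : ℝ) ≤ C := by
    simpa [hγ, prodDist] using h x hx
  refine Set.mem_biUnion (x := γ) (Nat.le_floor ?_) (Metric.mem_closedBall.2 ?_)
  · linarith [dist_nonneg (x := x) (y := γ • p.1)]
  · linarith [Nat.cast_nonneg (α := ℝ) (wordLength S (γ * p.2))]

end OrbitDistance

/-- Let `Γ` be a group with a finite generating set, with the word metric,
acting on a metric space `X` by isometries; equip `X × Γ` with the sum product metric and
the diagonal action.  Then (1) the infimum defining the orbit distance is attained, and the
orbit distance makes the orbit set `X^{bdd} = (X × Γ)/Γ` a metric space (it is invariant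
under changing representatives, nonnegative, zero on the diagonal, symmetric, satisfies the
triangle inequality, and vanishes only on equal orbits); (2) the natural map
`b : X → X^{bdd}`, `b x = [(x, e)]`, is a bijection; (3) `b` is a coarse map: eventually
continuous with `l r = r`, and proper. -/
theorem xbdd_metric_bijective_coarse {X : Type*} [MetricSpace X]
    {Γ : Type*} [Group Γ] [MulAction Γ X]
    (hiso : ∀ γ : Γ, Isometry (fun x : X => γ • x))
    (Sgen : Finset Γ) (hgen : Subgroup.closure (Sgen : Set Γ) = ⊤) :
    -- (1) the infimum is attained …
    (∀ p q : X × Γ, ∃ γ₀ : Γ, ∀ γ : Γ, prodDist ↑Sgen p (γ₀ • q) ≤ prodDist ↑Sgen p (γ • q)) ∧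
    -- … and the orbit distance is a metric on the orbit set:
    (∀ (γ : Γ) (p q : X × Γ), bddDist ↑Sgen (γ • p) q = bddDist ↑Sgen p q) ∧
    (∀ (γ : Γ) (p q : X × Γ), bddDist ↑Sgen p (γ • q) = bddDist ↑Sgen p q) ∧
    (∀ p q : X × Γ, 0 ≤ bddDist ↑Sgen p q) ∧
    (∀ p : X × Γ, bddDist ↑Sgen p p = 0) ∧
    (∀ p q : X × Γ, bddDist ↑Sgen p q = bddDist ↑Sgen q p) ∧
    (∀ p q r : X × Γ, bddDist ↑Sgen p r ≤ bddDist ↑Sgen p q + bddDist ↑Sgen q r) ∧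
    (∀ p q : X × Γ, bddDist ↑Sgen p q = 0 → q ∈ MulAction.orbit Γ p) ∧
    -- (2) `b` is a bijection onto the orbit set
    Function.Bijective
      (fun x : X => Quotient.mk (MulAction.orbitRel Γ (X × Γ)) (x, (1 : Γ))) ∧
    -- (3) `b` is a coarse map: eventually continuous with `l r = r` …
    (∀ x₁ x₂ : X, bddDist ↑Sgen (x₁, (1 : Γ)) (x₂, (1 : Γ)) ≤ dist x₁ x₂) ∧
    -- … and proper
    (∀ (B : Set X) (p : X × Γ) (C : ℝ),
      (∀ x ∈ B, bddDist ↑Sgen (x, (1 : Γ)) p ≤ C) → Bornology.IsBounded B) := by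
  have hfin := Sgen.finite_toSet
  refine ⟨exists_forall_prodDist_smul_le hfin hgen, fun γ p q => ?_, bddDist_smul_right,
    bddDist_nonneg, fun p => ?_, bddDist_comm hiso hgen, bddDist_triangle hiso hfin hgen,
    fun p q => mem_orbit_of_bddDist_eq_zero hfin hgen, bijective_mk_prod_one, fun x₁ x₂ => ?_,
    fun B p C => isBounded_of_bddDist_le hfin hgen⟩
  · rw [bddDist_comm hiso hgen, bddDist_smul_right, bddDist_comm hiso hgen]
  · exact ((bddDist_le_prodDist p p).trans_eq (prodDist_self p)).antisymm (bddDist_nonneg p p)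
  · exact (bddDist_le_prodDist _ _).trans_eq (by simp [prodDist])
end

section
/- In Euclidean space ℝⁿ (n ≥ 1) consider, for 1 ≤ i ≤ n, the subsets E⁺_i = {(x₁,…,xₙ) : x_l = 0 for all l > i and x_i ≥ 0}, E⁻_i = {(x₁,…,xₙ) : x_l = 0 for all l > i and x_i ≤ 0}, and E₀ = E⁺₀ = E⁻₀ = {0}. Then the collection of all these subsets consists of pairwise coarsely antithetic closed subsets of ℝⁿ whose union is ℝⁿ (indeed E⁺ₙ ∪ E⁻ₙ = ℝⁿ), and E⁺_{i+1} ∩ E⁻_{i+1} = E⁺_i ∪ E⁻_i for 0 ≤ i < n. -/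
/-- A pair of subsets `U`, `V` of a metric space is coarsely antithetic if for each `K > 0`
there is `K' > 0` with `U[K] ∩ V[K] ⊆ (U ∩ V)[K']`. -/
def CoarselyAntithetic {X : Type*} [MetricSpace X] (U V : Set X) : Prop :=
  ∀ K : ℝ, 0 < K → ∃ K' : ℝ, 0 < K' ∧
    Metric.cthickening K U ∩ Metric.cthickening K V ⊆ Metric.cthickening K' (U ∩ V)

/-- The subset `E⁺_i ⊆ ℝⁿ` (`0 ≤ i ≤ n`, coordinates written `x₁, …, xₙ`, so the
coordinate `x_l` is `x ⟨l-1⟩`): all coordinates `x_l` with `l > i` vanish and `x_i ≥ 0`.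
For `i = 0` the positivity condition is vacuous and `E⁺_0 = {0}`. -/
def Eplus (n i : ℕ) : Set (EuclideanSpace ℝ (Fin n)) :=
  {x | (∀ k : Fin n, i ≤ (k : ℕ) → x k = 0) ∧ ∀ k : Fin n, (k : ℕ) + 1 = i → 0 ≤ x k}

/-- The subset `E⁻_i ⊆ ℝⁿ`: all coordinates `x_l` with `l > i` vanish and `x_i ≤ 0`. -/
def Eminus (n i : ℕ) : Set (EuclideanSpace ℝ (Fin n)) :=
  {x | (∀ k : Fin n, i ≤ (k : ℕ) → x k = 0) ∧ ∀ k : Fin n, (k : ℕ) + 1 = i → x k ≤ 0}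

namespace CoarselyAntithetic

variable {X : Type*} [MetricSpace X] {U V : Set X}

theorem symm (h : CoarselyAntithetic U V) : CoarselyAntithetic V U := by
  intro K hK
  obtain ⟨K', hK', hsub⟩ := h K hK
  exact ⟨K', hK', by rwa [Set.inter_comm, Set.inter_comm V U]⟩

theorem of_subset (h : U ⊆ V) : CoarselyAntithetic U V := fun K hK =>
  ⟨K, hK, by rw [Set.inter_eq_left.2 h]; exact Set.inter_subset_left⟩

/-- It suffices to find, near each `u ∈ U` that is close to some `v ∈ V`, a point of `U ∩ V`
that is no further from `u` than `v` is. -/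
theorem of_exists_dist_le (h : ∀ u ∈ U, ∀ v ∈ V, ∃ w ∈ U ∩ V, dist u w ≤ dist u v) :
    CoarselyAntithetic U V := by
  intro K hK
  refine ⟨6 * K, by positivity, ?_⟩
  rintro x ⟨hxU, hxV⟩
  have hlt : K < 2 * K := by linarith
  have hpos : 0 < 2 * K := by linarith
  obtain ⟨u, hu, hxu⟩ :=
    Metric.mem_thickening_iff.1 (Metric.cthickening_subset_thickening' hpos hlt U hxU)
  obtain ⟨v, hv, hxv⟩ :=
    Metric.mem_thickening_iff.1 (Metric.cthickening_subset_thickening' hpos hlt V hxV)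
  obtain ⟨w, hw, huw⟩ := h u hu v hv
  refine Metric.mem_cthickening_of_dist_le x w _ _ hw ?_
  linarith [dist_triangle x u w, dist_triangle_left u v x]

end CoarselyAntithetic

theorem isClosed_Eplus (n i : ℕ) : IsClosed (Eplus n i) := by
  simp only [Eplus, Set.ofPred_and, Set.ofPred_forall]
  refine .inter (isClosed_iInter fun k => isClosed_iInter fun _ => ?_)
    (isClosed_iInter fun k => isClosed_iInter fun _ => ?_)
  · exact isClosed_eq (by fun_prop) continuous_const
  · exact isClosed_le continuous_const (by fun_prop)

theorem isClosed_Eminus (n i : ℕ) : IsClosed (Eminus n i) := by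
  simp only [Eminus, Set.ofPred_and, Set.ofPred_forall]
  refine .inter (isClosed_iInter fun k => isClosed_iInter fun _ => ?_)
    (isClosed_iInter fun k => isClosed_iInter fun _ => ?_)
  · exact isClosed_eq (by fun_prop) continuous_const
  · exact isClosed_le (by fun_prop) continuous_const

theorem Eplus_zero (n : ℕ) : Eplus n 0 = {0} := by
  ext x
  simp [Eplus, PiLp.ext_iff]

theorem Eminus_zero (n : ℕ) : Eminus n 0 = {0} := by
  ext x
  simp [Eminus, PiLp.ext_iff]

theorem Eplus_union_Eminus (n i : ℕ) :
    Eplus n i ∪ Eminus n i = {x | ∀ k : Fin n, i ≤ (k : ℕ) → x k = 0} := by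
  ext x
  refine ⟨fun h => h.elim And.left And.left, fun h => ?_⟩
  by_cases hpos : ∀ k : Fin n, (k : ℕ) + 1 = i → 0 ≤ x k
  · exact .inl ⟨h, hpos⟩
  · push Not at hpos
    obtain ⟨m, hm, hxm⟩ := hpos
    refine .inr ⟨h, fun k hk => ?_⟩
    obtain rfl : k = m := Fin.ext (by omega)
    exact hxm.le

theorem Eplus_inter_Eminus_succ (n i : ℕ) :
    Eplus n (i + 1) ∩ Eminus n (i + 1) = Eplus n i ∪ Eminus n i := by
  rw [Eplus_union_Eminus]
  ext x
  constructor
  · rintro ⟨⟨h, hp⟩, -, hm⟩ k hk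
    rcases hk.eq_or_lt with hk | hk
    · exact le_antisymm (hm k (by omega)) (hp k (by omega))
    · exact h k hk
  · intro h
    exact ⟨⟨fun k hk => h k (by omega), fun k hk => (h k (by omega)).ge⟩,
      fun k hk => h k (by omega), fun k hk => (h k (by omega)).le⟩

theorem Eplus_union_Eminus_subset {n i j : ℕ} (hij : i < j) :
    Eplus n i ∪ Eminus n i ⊆ Eplus n j ∩ Eminus n j := by
  rw [Eplus_union_Eminus]
  intro x h
  exact ⟨⟨fun k hk => h k (by omega), fun k hk => (h k (by omega)).ge⟩,
    fun k hk => h k (by omega), fun k hk => (h k (by omega)).le⟩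

theorem coarselyAntithetic_Eplus_Eminus {n i : ℕ} (hi : i ≤ n) :
    CoarselyAntithetic (Eplus n i) (Eminus n i) := by
  obtain _ | m := i
  · rw [Eplus_zero, Eminus_zero]
    exact .of_subset subset_rfl
  refine .of_exists_dist_le fun u hu v hv => ?_
  let k : Fin n := ⟨m, hi⟩
  refine ⟨u - EuclideanSpace.single k (u k), ?_, ?_⟩
  · rw [Eplus_inter_Eminus_succ, Eplus_union_Eminus]
    intro l hl
    by_cases hlk : l = k
    · simp [hlk]
    · have : (l : ℕ) ≠ m := fun h => hlk (Fin.ext h)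
      simp [hlk, hu.1 l (by omega)]
  · have hu0 : 0 ≤ u k := hu.2 k rfl
    have hv0 : v k ≤ 0 := hv.2 k rfl
    calc dist u (u - EuclideanSpace.single k (u k)) = u k := by
          simp [abs_of_nonneg hu0]
      _ ≤ |u k - v k| := by linarith [le_abs_self (u k - v k)]
      _ ≤ dist u v := by
          rw [dist_eq_norm]
          exact PiLp.norm_apply_le (u - v) k

/-- In `ℝⁿ` (`n ≥ 1`) the subsets `E⁺_i`, `E⁻_i` (`0 ≤ i ≤ n`) are
closed, pairwise coarsely antithetic, their union is all of `ℝⁿ` (indeed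
`E⁺_n ∪ E⁻_n = ℝⁿ`), one has `E⁺_0 = E⁻_0 = {0}`, and
`E⁺_{i+1} ∩ E⁻_{i+1} = E⁺_i ∪ E⁻_i` for `0 ≤ i < n`. -/
theorem euclidean_antithetic_family (n : ℕ) (hn : 1 ≤ n) :
    -- the sets are closed
    (∀ i ≤ n, IsClosed (Eplus n i) ∧ IsClosed (Eminus n i)) ∧
    -- `E₀ = {0}`
    (Eplus n 0 = {0} ∧ Eminus n 0 = {0}) ∧
    -- pairwise coarsely antithetic
    (∀ i ≤ n, ∀ j ≤ n,
      CoarselyAntithetic (Eplus n i) (Eplus n j) ∧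
      CoarselyAntithetic (Eplus n i) (Eminus n j) ∧
      CoarselyAntithetic (Eminus n i) (Eminus n j)) ∧
    -- the union of the family is `ℝⁿ`, indeed already `E⁺_n ∪ E⁻_n = ℝⁿ`
    (Eplus n n ∪ Eminus n n = Set.univ) ∧
    ((⋃ i ∈ Finset.range (n + 1), (Eplus n i ∪ Eminus n i)) = Set.univ) ∧
    -- intersections: `E⁺_{i+1} ∩ E⁻_{i+1} = E⁺_i ∪ E⁻_i`
    (∀ i < n, Eplus n (i + 1) ∩ Eminus n (i + 1) = Eplus n i ∪ Eminus n i) := by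
  have huniv : Eplus n n ∪ Eminus n n = Set.univ := by
    rw [Eplus_union_Eminus]
    exact Set.eq_univ_of_forall fun x k hk => absurd k.isLt (by omega)
  refine ⟨fun i _ => ⟨isClosed_Eplus n i, isClosed_Eminus n i⟩,
    ⟨Eplus_zero n, Eminus_zero n⟩, fun i hi j _ => ?_, ?_, ?_,
    fun i _ => Eplus_inter_Eminus_succ n i⟩
  · rcases lt_trichotomy i j with h | rfl | h
    · have hsub := Eplus_union_Eminus_subset (n := n) h
      rw [Set.union_subset_iff, Set.subset_inter_iff, Set.subset_inter_iff] at hsub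
      obtain ⟨⟨hpp, hpm⟩, -, hmm⟩ := hsub
      exact ⟨.of_subset hpp, .of_subset hpm, .of_subset hmm⟩
    · exact ⟨.of_subset subset_rfl, coarselyAntithetic_Eplus_Eminus hi, .of_subset subset_rfl⟩
    · have hsub := Eplus_union_Eminus_subset (n := n) h
      rw [Set.union_subset_iff, Set.subset_inter_iff, Set.subset_inter_iff] at hsub
      obtain ⟨⟨hpp, -⟩, hmp, hmm⟩ := hsub
      exact ⟨.symm (.of_subset hpp), .symm (.of_subset hmp), .symm (.of_subset hmm)⟩
  · exact huniv
  · refine Set.eq_univ_of_univ_subset ?_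
    rw [← huniv]
    exact Set.subset_biUnion_of_mem (u := fun i => Eplus n i ∪ Eminus n i)
      (Finset.mem_coe.2 (Finset.self_mem_range_succ n))
end

section
/- Let n ≥ 1 and equip the set ℝⁿ × ℝ with the metric of Tℝⁿ, the chain metric determined by ρ as in the T-construction applied to Euclidean space ℝⁿ. For 1 ≤ i ≤ n let E⁺_i = {(x₁,…,xₙ) : x_l = 0 for all l > i and x_i ≥ 0}, E⁻_i = {(x₁,…,xₙ) : x_l = 0 for all l > i and x_i ≤ 0}, and E₀ = {0}. Then the subsets TE⁺_i = E⁺_i × ℝ, TE⁻_i = E⁻_i × ℝ (0 ≤ i ≤ n) form a coarsely antithetic covering of Tℝⁿ: they are pairwise coarsely antithetic subsets of the metric space Tℝⁿ, and their union is all of Tℝⁿ. -/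
/-- The chain (pseudo)distance associated to a relation `S` on `Z` and a weight
function `ρ`: the infimum over chains with consecutive terms `S`-related of the sum of the
`ρ`-values of consecutive pairs (equivalently, the largest pseudometric `≤ ρ` on `S`). -/
noncomputable def chainDist {Z : Type*} (S : Z → Z → Prop) (ρ : Z → Z → ℝ) (z₁ z₂ : Z) : ℝ :=
  sInf {c : ℝ | ∃ (n : ℕ) (w : ℕ → Z), w 0 = z₁ ∧ w n = z₂ ∧
    (∀ i < n, S (w i) (w (i + 1))) ∧ c = ∑ i ∈ Finset.range n, ρ (w i) (w (i + 1))}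

/-- The relation underlying the `T`-construction on a metric space `X`: two points of
`X × ℝ` are related if they share the `X`-coordinate or the `ℝ`-coordinate. -/
def TRel (X : Type*) [MetricSpace X] (p q : X × ℝ) : Prop :=
  p.1 = q.1 ∨ p.2 = q.2

/-- The weight function of the `T`-construction: `ρ((x,r),(x,r')) = |r - r'|` and
`ρ((x,r),(x',r)) = d(x,x')` if `r ≤ 1`, `r·d(x,x')` if `r ≥ 1`. -/
noncomputable def TRho (X : Type*) [MetricSpace X] [DecidableEq X] (p q : X × ℝ) : ℝ :=
  if p.1 = q.1 then |p.2 - q.2|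
  else if p.2 ≤ 1 then dist p.1 q.1 else p.2 * dist p.1 q.1

/-- The metric of `TX`: the chain metric determined by `TRho` on `TRel`-related pairs. -/
noncomputable def TDist (X : Type*) [MetricSpace X] [DecidableEq X] (p q : X × ℝ) : ℝ :=
  chainDist (TRel X) (TRho X) p q

/-- The `D`-neighborhood `A[D] = {p : d_T(p, A) ≤ D}` of a subset `A ⊆ TX`. -/
noncomputable def TNbhd (X : Type*) [MetricSpace X] [DecidableEq X]
    (D : ℝ) (A : Set (X × ℝ)) : Set (X × ℝ) :=
  {p | sInf (TDist X p '' A) ≤ D}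

/-- Coarse antitheticity of subsets of `TX` with respect to the metric of `TX`. -/
def TCoarselyAntithetic (X : Type*) [MetricSpace X] [DecidableEq X]
    (U V : Set (X × ℝ)) : Prop :=
  ∀ K : ℝ, 0 < K → ∃ K' : ℝ, 0 < K' ∧ TNbhd X K U ∩ TNbhd X K V ⊆ TNbhd X K' (U ∩ V)

section Chain

variable {Z : Type*} {S : Z → Z → Prop} {ρ : Z → Z → ℝ}

/-- The set of costs of chains joining two points. -/
def chainCosts (S : Z → Z → Prop) (ρ : Z → Z → ℝ) (z₁ z₂ : Z) : Set ℝ :=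
  {c : ℝ | ∃ (n : ℕ) (w : ℕ → Z), w 0 = z₁ ∧ w n = z₂ ∧
    (∀ i < n, S (w i) (w (i + 1))) ∧ c = ∑ i ∈ Finset.range n, ρ (w i) (w (i + 1))}

theorem chainDist_eq_sInf (z₁ z₂ : Z) : chainDist S ρ z₁ z₂ = sInf (chainCosts S ρ z₁ z₂) := rfl

theorem nonneg_of_mem_chainCosts (hρ : ∀ p q, 0 ≤ ρ p q) {a b : Z} {c : ℝ}
    (hc : c ∈ chainCosts S ρ a b) : 0 ≤ c := by
  obtain ⟨n, w, -, -, -, rfl⟩ := hc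
  exact Finset.sum_nonneg fun i _ => hρ _ _

theorem bddBelow_chainCosts (hρ : ∀ p q, 0 ≤ ρ p q) (a b : Z) :
    BddBelow (chainCosts S ρ a b) :=
  ⟨0, fun _ hc => nonneg_of_mem_chainCosts hρ hc⟩

theorem chainDist_nonneg (hρ : ∀ p q, 0 ≤ ρ p q) (a b : Z) : 0 ≤ chainDist S ρ a b :=
  Real.sInf_nonneg fun _ hc => nonneg_of_mem_chainCosts hρ hc

theorem add_mem_chainCosts {a b c : Z} {s t : ℝ} (hs : s ∈ chainCosts S ρ a b)
    (ht : t ∈ chainCosts S ρ b c) : s + t ∈ chainCosts S ρ a c := by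
  obtain ⟨n, w, hw0, hwn, hw, rfl⟩ := hs
  obtain ⟨m, v, hv0, hvm, hv, rfl⟩ := ht
  have hleft : ∀ i ≤ n, (if i ≤ n then w i else v (i - n)) = w i := fun i hi => if_pos hi
  have hright : ∀ i, (if n + i ≤ n then w (n + i) else v (n + i - n)) = v i := by
    intro i
    rcases Nat.eq_zero_or_pos i with rfl | hi
    · simp [hwn, hv0]
    · rw [if_neg (by omega), Nat.add_sub_cancel_left]
  refine ⟨n + m, fun i => if i ≤ n then w i else v (i - n), ?_, ?_, ?_, ?_⟩
  · simpa using hw0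
  · exact (hright m).trans hvm
  · intro i hi
    rcases lt_or_ge i n with h | h
    · simpa only [hleft i h.le, hleft (i + 1) h] using hw i h
    · obtain ⟨j, rfl⟩ := Nat.exists_eq_add_of_le h
      simpa only [add_assoc, hright] using hv j (by omega)
  · rw [Finset.sum_range_add]
    congr 1
    · refine Finset.sum_congr rfl fun i hi => ?_
      have hi := Finset.mem_range.1 hi
      simp only [hleft i hi.le, hleft (i + 1) hi]
    · refine Finset.sum_congr rfl fun i _ => ?_
      simp only [add_assoc, hright]

theorem mem_chainCosts_of_rel {a b : Z} (h : S a b) : ρ a b ∈ chainCosts S ρ a b := by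
  refine ⟨1, fun i => if i = 0 then a else b, by simp, by simp, ?_, by simp⟩
  intro i hi
  obtain rfl : i = 0 := by omega
  simpa using h

theorem mem_chainCosts_symm (hS : ∀ p q, S p q → S q p) (hρ : ∀ p q, S p q → ρ p q = ρ q p)
    {a b : Z} {c : ℝ} (hc : c ∈ chainCosts S ρ a b) : c ∈ chainCosts S ρ b a := by
  obtain ⟨n, w, rfl, rfl, hw, rfl⟩ := hc
  refine ⟨n, fun i => w (n - i), by simp, by simp, ?_, ?_⟩
  · intro i hi
    have := hS _ _ (hw (n - (i + 1)) (by omega))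
    rwa [show n - (i + 1) + 1 = n - i by omega] at this
  · rw [← Finset.sum_range_reflect]
    refine Finset.sum_congr rfl fun i hi => ?_
    have hi := Finset.mem_range.1 hi
    rw [hρ _ _ (hw _ (by omega)), show n - 1 - i + 1 = n - i by omega,
      show n - 1 - i = n - (i + 1) by omega]

theorem chainDist_comm (hS : ∀ p q, S p q → S q p) (hρ : ∀ p q, S p q → ρ p q = ρ q p)
    (a b : Z) : chainDist S ρ a b = chainDist S ρ b a := by
  rw [chainDist_eq_sInf, chainDist_eq_sInf]
  exact congrArg sInf (Set.ext fun _ =>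
    ⟨mem_chainCosts_symm hS hρ, mem_chainCosts_symm hS hρ⟩)

theorem chainDist_triangle (hρ : ∀ p q, 0 ≤ ρ p q)
    (hne : ∀ a b, (chainCosts S ρ a b).Nonempty) (a b c : Z) :
    chainDist S ρ a c ≤ chainDist S ρ a b + chainDist S ρ b c := by
  refine le_of_forall_pos_lt_add fun ε hε => ?_
  obtain ⟨s, hs, hs'⟩ := Real.lt_sInf_add_pos (hne a b) (half_pos hε)
  obtain ⟨t, ht, ht'⟩ := Real.lt_sInf_add_pos (hne b c) (half_pos hε)
  have := csInf_le (bddBelow_chainCosts hρ a c) (add_mem_chainCosts hs ht)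
  simp only [chainDist_eq_sInf]
  linarith

theorem chainDist_map_le (hρ : ∀ p q, 0 ≤ ρ p q)
    (hne : ∀ a b, (chainCosts S ρ a b).Nonempty) {F : Z → Z}
    (hF : ∀ p q, S p q → S (F p) (F q)) (hFρ : ∀ p q, S p q → ρ (F p) (F q) ≤ ρ p q) (a b : Z) :
    chainDist S ρ (F a) (F b) ≤ chainDist S ρ a b := by
  refine le_csInf (hne a b) ?_
  rintro _ ⟨n, w, rfl, rfl, hw, rfl⟩
  refine (csInf_le (bddBelow_chainCosts hρ _ _)
    ⟨n, F ∘ w, rfl, rfl, fun i hi => hF _ _ (hw i hi), rfl⟩).trans ?_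
  exact Finset.sum_le_sum fun i hi => hFρ _ _ (hw i (Finset.mem_range.1 hi))

end Chain

section TConstruction

variable {X : Type*} [MetricSpace X]

theorem TRel_symm (p q : X × ℝ) (h : TRel X p q) : TRel X q p :=
  h.imp Eq.symm Eq.symm

variable [DecidableEq X]

theorem TRho_nonneg (p q : X × ℝ) : 0 ≤ TRho X p q := by
  unfold TRho
  split_ifs with h1 h2
  · exact abs_nonneg _
  · exact dist_nonneg
  · exact mul_nonneg (by linarith) dist_nonneg

theorem TRho_comm (p q : X × ℝ) (h : TRel X p q) : TRho X p q = TRho X q p := by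
  unfold TRho
  by_cases h1 : p.1 = q.1
  · rw [if_pos h1, if_pos h1.symm, abs_sub_comm]
  · rw [if_neg h1, if_neg (Ne.symm h1), h.resolve_left h1, dist_comm]

theorem chainCosts_TRho_nonempty (p q : X × ℝ) :
    (chainCosts (TRel X) (TRho X) p q).Nonempty :=
  ⟨_, add_mem_chainCosts (b := (p.1, q.2))
    (mem_chainCosts_of_rel (Or.inl rfl)) (mem_chainCosts_of_rel (Or.inr rfl))⟩

theorem TDist_nonneg (p q : X × ℝ) : 0 ≤ TDist X p q :=
  chainDist_nonneg TRho_nonneg p q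

theorem TDist_comm (p q : X × ℝ) : TDist X p q = TDist X q p :=
  chainDist_comm TRel_symm TRho_comm p q

theorem TDist_triangle (p q r : X × ℝ) : TDist X p r ≤ TDist X p q + TDist X q r :=
  chainDist_triangle TRho_nonneg chainCosts_TRho_nonempty p q r

theorem TDist_map_le {f : X → X} (hf : ∀ x y, dist (f x) (f y) ≤ dist x y) (p q : X × ℝ) :
    TDist X (f p.1, p.2) (f q.1, q.2) ≤ TDist X p q := by
  refine chainDist_map_le (F := fun p : X × ℝ => (f p.1, p.2)) TRho_nonneg
    chainCosts_TRho_nonempty (fun p q h => h.imp (congrArg f) id) (fun p q h => ?_) p q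
  by_cases h1 : p.1 = q.1
  · simp [TRho, h1]
  · have h2 := h.resolve_left h1
    by_cases h3 : f p.1 = f q.1
    · simpa [TRho, h3, h2] using TRho_nonneg p q
    · simp only [TRho, h1, h3, if_false]
      split_ifs with h4
      · exact hf _ _
      · exact mul_le_mul_of_nonneg_left (hf _ _) (by linarith)

/-- If a nonexpansive retraction onto `A` maps `B` into itself, then `TA` and `TB` are coarsely
antithetic. -/
theorem TCoarselyAntithetic_of_retraction {A B : Set X} (hA : A.Nonempty) (hB : B.Nonempty)
    {f : X → X} (hf : ∀ x y, dist (f x) (f y) ≤ dist x y) (hfA : ∀ x, f x ∈ A)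
    (hfix : ∀ x ∈ A, f x = x) (hfB : ∀ x ∈ B, f x ∈ B) :
    TCoarselyAntithetic X (A ×ˢ (Set.univ : Set ℝ)) (B ×ˢ (Set.univ : Set ℝ)) := by
  intro K hK
  refine ⟨3 * (K + 1), by linarith, ?_⟩
  rintro p ⟨hpA, hpB⟩
  have near : ∀ C : Set X, C.Nonempty → p ∈ TNbhd X K (C ×ˢ (Set.univ : Set ℝ)) →
      ∃ u : X × ℝ, u.1 ∈ C ∧ TDist X p u < K + 1 := by
    intro C hC hp
    obtain ⟨_, ⟨u, hu, rfl⟩, hlt⟩ := exists_lt_of_csInf_lt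
      ((hC.prod Set.univ_nonempty).image (TDist X p)) (lt_of_le_of_lt hp (lt_add_one K))
    exact ⟨u, hu.1, hlt⟩
  obtain ⟨u, hu, hpu⟩ := near A hA hpA
  obtain ⟨v, hv, hpv⟩ := near B hB hpB
  have huv := TDist_map_le hf u v
  rw [hfix _ hu] at huv
  have h1 := TDist_triangle p u (f v.1, v.2)
  have h2 := TDist_triangle u p v
  rw [TDist_comm u p] at h2
  have h3 : sInf (TDist X p '' ((A ×ˢ Set.univ) ∩ (B ×ˢ Set.univ))) ≤ TDist X p (f v.1, v.2) :=
    csInf_le ⟨0, by rintro _ ⟨q, -, rfl⟩; exact TDist_nonneg p q⟩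
      ⟨(f v.1, v.2), ⟨⟨hfA _, trivial⟩, ⟨hfB _ hv, trivial⟩⟩, rfl⟩
  refine h3.trans (h1.trans ?_)
  change TDist X u (f v.1, v.2) ≤ _ at huv
  linarith

end TConstruction

/-- The map of `ℝⁿ` keeping the coordinates `x_l` with `l < i`, applying `g` to `x_i`, and
replacing the coordinates `x_l` with `l > i` by `0`. -/
noncomputable def truncateWith (n i : ℕ) (g : ℝ → ℝ) (x : EuclideanSpace ℝ (Fin n)) :
    EuclideanSpace ℝ (Fin n) :=
  WithLp.toLp 2 fun k =>
    if (k : ℕ) + 1 < i then x k else if (k : ℕ) + 1 = i then g (x k) else 0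

theorem truncateWith_apply {n : ℕ} (i : ℕ) (g : ℝ → ℝ) (x : EuclideanSpace ℝ (Fin n)) (k : Fin n) :
    truncateWith n i g x k =
      if (k : ℕ) + 1 < i then x k else if (k : ℕ) + 1 = i then g (x k) else 0 := rfl

theorem dist_truncateWith_le {n i : ℕ} {g : ℝ → ℝ} (hg : ∀ a b, |g a - g b| ≤ |a - b|)
    (x y : EuclideanSpace ℝ (Fin n)) :
    dist (truncateWith n i g x) (truncateWith n i g y) ≤ dist x y := by
  rw [EuclideanSpace.dist_eq, EuclideanSpace.dist_eq]
  refine Real.sqrt_le_sqrt (Finset.sum_le_sum fun k _ => ?_)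
  refine pow_le_pow_left₀ dist_nonneg ?_ 2
  rw [Real.dist_eq, Real.dist_eq, truncateWith_apply, truncateWith_apply]
  split_ifs
  · exact le_rfl
  · exact hg _ _
  · simp

theorem truncateWith_eq_self {n i : ℕ} {g : ℝ → ℝ} {x : EuclideanSpace ℝ (Fin n)}
    (h0 : ∀ k : Fin n, i ≤ (k : ℕ) → x k = 0) (hg : ∀ k : Fin n, (k : ℕ) + 1 = i → g (x k) = x k) :
    truncateWith n i g x = x := by
  ext k
  rw [truncateWith_apply]
  split_ifs with h1 h2
  · rfl
  · exact hg k h2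
  · exact (h0 k (by omega)).symm

theorem truncateWith_max_mem_Eplus (n i : ℕ) (x : EuclideanSpace ℝ (Fin n)) :
    truncateWith n i (max · 0) x ∈ Eplus n i := by
  refine ⟨fun k hk => ?_, fun k hk => ?_⟩
  · rw [truncateWith_apply, if_neg (by omega), if_neg (by omega)]
  · rw [truncateWith_apply, if_neg (by omega), if_pos hk]
    exact le_max_right _ _

theorem truncateWith_min_mem_Eminus (n i : ℕ) (x : EuclideanSpace ℝ (Fin n)) :
    truncateWith n i (min · 0) x ∈ Eminus n i := by
  refine ⟨fun k hk => ?_, fun k hk => ?_⟩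
  · rw [truncateWith_apply, if_neg (by omega), if_neg (by omega)]
  · rw [truncateWith_apply, if_neg (by omega), if_pos hk]
    exact min_le_right _ _

theorem truncateWith_mem_Eplus {n i j : ℕ} {g : ℝ → ℝ} (h0 : g 0 = 0)
    (hg : ∀ a, 0 ≤ a → 0 ≤ g a) {x : EuclideanSpace ℝ (Fin n)} (hx : x ∈ Eplus n j) :
    truncateWith n i g x ∈ Eplus n j := by
  refine ⟨fun k hk => ?_, fun k hk => ?_⟩
  · rw [truncateWith_apply, hx.1 k hk, h0]
    simp
  · rw [truncateWith_apply]
    have := hx.2 k hk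
    split_ifs
    exacts [this, hg _ this, le_rfl]

theorem truncateWith_mem_Eminus {n i j : ℕ} {g : ℝ → ℝ} (h0 : g 0 = 0)
    (hg : ∀ a, a ≤ 0 → g a ≤ 0) {x : EuclideanSpace ℝ (Fin n)} (hx : x ∈ Eminus n j) :
    truncateWith n i g x ∈ Eminus n j := by
  refine ⟨fun k hk => ?_, fun k hk => ?_⟩
  · rw [truncateWith_apply, hx.1 k hk, h0]
    simp
  · rw [truncateWith_apply]
    have := hx.2 k hk
    split_ifs
    exacts [this, hg _ this, le_rfl]

theorem zero_mem_Eplus (n i : ℕ) : (0 : EuclideanSpace ℝ (Fin n)) ∈ Eplus n i :=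
  ⟨fun _ _ => rfl, fun _ _ => le_rfl⟩

theorem zero_mem_Eminus (n i : ℕ) : (0 : EuclideanSpace ℝ (Fin n)) ∈ Eminus n i :=
  ⟨fun _ _ => rfl, fun _ _ => le_rfl⟩

theorem mem_Eplus_or_mem_Eminus {n : ℕ} (hn : 1 ≤ n) (x : EuclideanSpace ℝ (Fin n)) :
    x ∈ Eplus n n ∨ x ∈ Eminus n n := by
  have last : ∀ k : Fin n, (k : ℕ) + 1 = n → k = ⟨n - 1, by omega⟩ := fun k hk =>
    Fin.ext (Nat.eq_sub_of_add_eq hk)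
  rcases le_total 0 (x ⟨n - 1, by omega⟩) with h | h
  · exact Or.inl ⟨fun k hk => absurd k.2 (by omega), fun k hk => by rwa [last k hk]⟩
  · exact Or.inr ⟨fun k hk => absurd k.2 (by omega), fun k hk => by rwa [last k hk]⟩

open scoped Classical in
/-- In `Tℝⁿ = ℝⁿ × ℝ` with the chain metric of the `T`-construction,
the subsets `TE⁺_i = E⁺_i × ℝ` and `TE⁻_i = E⁻_i × ℝ` (`0 ≤ i ≤ n`) form a coarsely
antithetic covering of `Tℝⁿ`: they are pairwise coarsely antithetic and their union is all
of `Tℝⁿ`. -/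
theorem T_euclidean_antithetic_covering (n : ℕ) (hn : 1 ≤ n) :
    (∀ i ≤ n, ∀ j ≤ n,
      TCoarselyAntithetic (EuclideanSpace ℝ (Fin n))
        (Eplus n i ×ˢ (Set.univ : Set ℝ)) (Eplus n j ×ˢ (Set.univ : Set ℝ)) ∧
      TCoarselyAntithetic (EuclideanSpace ℝ (Fin n))
        (Eplus n i ×ˢ (Set.univ : Set ℝ)) (Eminus n j ×ˢ (Set.univ : Set ℝ)) ∧
      TCoarselyAntithetic (EuclideanSpace ℝ (Fin n))
        (Eminus n i ×ˢ (Set.univ : Set ℝ)) (Eminus n j ×ˢ (Set.univ : Set ℝ))) ∧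
    ((⋃ i ∈ Finset.range (n + 1),
        (Eplus n i ×ˢ (Set.univ : Set ℝ) ∪ Eminus n i ×ˢ (Set.univ : Set ℝ))) =
      Set.univ) := by
  have hmax (a b : ℝ) : |max a 0 - max b 0| ≤ |a - b| := abs_max_sub_max_le_abs a b 0
  have hmin (a b : ℝ) : |min a 0 - min b 0| ≤ |a - b| := by
    simpa using abs_min_sub_min_le_max a 0 b 0
  refine ⟨fun i _ j _ => ⟨?_, ?_, ?_⟩, ?_⟩
  · exact TCoarselyAntithetic_of_retraction ⟨0, zero_mem_Eplus n i⟩ ⟨0, zero_mem_Eplus n j⟩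
      (dist_truncateWith_le hmax) (truncateWith_max_mem_Eplus n i)
      (fun x hx => truncateWith_eq_self hx.1 fun k hk => max_eq_left (hx.2 k hk))
      (fun x hx => truncateWith_mem_Eplus (g := (max · 0)) (max_self 0)
        (fun a _ => le_max_right a 0) hx)
  · exact TCoarselyAntithetic_of_retraction ⟨0, zero_mem_Eplus n i⟩ ⟨0, zero_mem_Eminus n j⟩
      (dist_truncateWith_le hmax) (truncateWith_max_mem_Eplus n i)
      (fun x hx => truncateWith_eq_self hx.1 fun k hk => max_eq_left (hx.2 k hk))
      (fun x hx => truncateWith_mem_Eminus (g := (max · 0)) (max_self 0)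
        (fun a ha => max_le ha le_rfl) hx)
  · exact TCoarselyAntithetic_of_retraction ⟨0, zero_mem_Eminus n i⟩ ⟨0, zero_mem_Eminus n j⟩
      (dist_truncateWith_le hmin) (truncateWith_min_mem_Eminus n i)
      (fun x hx => truncateWith_eq_self hx.1 fun k hk => min_eq_left (hx.2 k hk))
      (fun x hx => truncateWith_mem_Eminus (g := (min · 0)) (min_self 0)
        (fun a _ => min_le_right a 0) hx)
  · refine Set.eq_univ_of_forall fun p => Set.mem_iUnion₂.2 ⟨n, Finset.self_mem_range_succ n, ?_⟩
    exact (mem_Eplus_or_mem_Eminus hn p.1).imp (fun h => ⟨h, trivial⟩) (fun h => ⟨h, trivial⟩)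
end
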